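/- The graph F(9,14,17), defined as the simple graph on vertex set {1,...,9} with edge set {{1,2},{2,3},{1,3},{2,4},{4,5},{3,5},{1,7},{6,7},{3,6},{4,8},{8,9},{5,9},{7,9},{6,8}}, is forbidden: there is no injective map φ : {1,...,9} → ℝ² with dist(φ(i), φ(j)) = 1 for every edge {i,j}. -/

import Mathlib

theorem rh_sq (x y : EuclideanSpace ℝ (Fin 2)) (h : dist x y = 1) :
    (x 0 - y 0)^2 + (x 1 - y 1)^2 = 1 := by
  rw [EuclideanSpace.dist_eq, Real.sqrt_eq_one] at h
  simpa [Fin.sum_univ_two, Real.dist_eq, sq_abs] using h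

theorem rh_pos (x y : EuclideanSpace ℝ (Fin 2)) (h : x ≠ y) :
    (x 0 - y 0)^2 + (x 1 - y 1)^2 ≠ 0 := by
  intro h0
  apply h
  have h1 : x 0 - y 0 = 0 := by nlinarith [sq_nonneg (x 0 - y 0), sq_nonneg (x 1 - y 1)]
  have h2 : x 1 - y 1 = 0 := by nlinarith [sq_nonneg (x 0 - y 0), sq_nonneg (x 1 - y 1)]
  ext i
  fin_cases i
  · exact sub_eq_zero.mp h1
  · exact sub_eq_zero.mp h2

theorem rh_lin (p0 p1 q0 q1 s0 s1 : ℝ) (hp : p0^2+p1^2 ≠ 0) (hq : q0^2+q1^2 ≠ 0)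
    (h : p0*q0+p1*q1 = 0) (h1 : s0*p0+s1*p1 = 0) (h2 : s0*q0+s1*q1=0) :
    s0 = 0 ∧ s1 = 0 := by
  have hd : p0*q1-p1*q0 ≠ 0 := by
    intro hd
    apply mul_ne_zero hp hq
    linear_combination (p0*q0+p1*q1)*h + (p0*q1-p1*q0)*hd
  constructor
  · apply (mul_eq_zero.mp (_ : (p0*q1-p1*q0)*s0 = 0)).resolve_left hd
    linear_combination q1*h1 - p1*h2
  · apply (mul_eq_zero.mp (_ : (p0*q1-p1*q0)*s1 = 0)).resolve_left hd
    linear_combination p0*h2 - q0*h1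

theorem rh_main (a b c d : EuclideanSpace ℝ (Fin 2)) (hac : a ≠ c) (hbd : b ≠ d)
    (h1 : dist a b = 1) (h2 : dist b c = 1) (h3 : dist c d = 1) (h4 : dist d a = 1) :
    a 0 + c 0 - b 0 - d 0 = 0 ∧ a 1 + c 1 - b 1 - d 1 = 0 := by
  have e1 := rh_sq _ _ h1
  have e2 := rh_sq _ _ h2
  have e3 := rh_sq _ _ h3
  have e4 := rh_sq _ _ h4
  apply rh_lin _ _ _ _ _ _ (rh_pos _ _ hac) (rh_pos _ _ hbd)
  · linear_combination (-e1 + e2 - e3 + e4)/2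
  · linear_combination (e1 - e2 - e3 + e4)/2
  · linear_combination (-e1 - e2 + e3 + e4)/2

theorem F_9_14_17_forbidden :
    ¬ ∃ φ : ℕ → EuclideanSpace ℝ (Fin 2),
      Set.InjOn φ (Set.Icc 1 9) ∧
      dist (φ 1) (φ 2) = 1 ∧
      dist (φ 2) (φ 3) = 1 ∧
      dist (φ 1) (φ 3) = 1 ∧
      dist (φ 2) (φ 4) = 1 ∧
      dist (φ 4) (φ 5) = 1 ∧
      dist (φ 3) (φ 5) = 1 ∧
      dist (φ 1) (φ 7) = 1 ∧
      dist (φ 6) (φ 7) = 1 ∧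
      dist (φ 3) (φ 6) = 1 ∧
      dist (φ 4) (φ 8) = 1 ∧
      dist (φ 8) (φ 9) = 1 ∧
      dist (φ 5) (φ 9) = 1 ∧
      dist (φ 7) (φ 9) = 1 ∧
      dist (φ 6) (φ 8) = 1 := by
  rintro ⟨φ, inj, h12, h23, h13, h24, h45, h35, h17, h67, h36, h48, h89, h59, h79, h68⟩
  have ne : ∀ i j : ℕ, 1 ≤ i → i ≤ 9 → 1 ≤ j → j ≤ 9 → i ≠ j → φ i ≠ φ j :=
    fun i j hi hi' hj hj' hij h => hij (inj ⟨hi, hi'⟩ ⟨hj, hj'⟩ h)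
  have r1 := rh_main (φ 2) (φ 4) (φ 5) (φ 3) (ne 2 5 (by norm_num) (by norm_num) (by norm_num) (by norm_num) (by norm_num)) (ne 4 3 (by norm_num) (by norm_num) (by norm_num) (by norm_num) (by norm_num))
    h24 h45 (by rwa [dist_comm]) (by rwa [dist_comm])
  have r2 := rh_main (φ 1) (φ 7) (φ 6) (φ 3) (ne 1 6 (by norm_num) (by norm_num) (by norm_num) (by norm_num) (by norm_num)) (ne 7 3 (by norm_num) (by norm_num) (by norm_num) (by norm_num) (by norm_num))
    h17 (by rwa [dist_comm]) (by rwa [dist_comm]) (by rwa [dist_comm])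
  have r3 := rh_main (φ 4) (φ 8) (φ 9) (φ 5) (ne 4 9 (by norm_num) (by norm_num) (by norm_num) (by norm_num) (by norm_num)) (ne 8 5 (by norm_num) (by norm_num) (by norm_num) (by norm_num) (by norm_num))
    h48 h89 (by rwa [dist_comm]) (by rwa [dist_comm])
  have r4 := rh_main (φ 6) (φ 8) (φ 9) (φ 7) (ne 6 9 (by norm_num) (by norm_num) (by norm_num) (by norm_num) (by norm_num)) (ne 8 7 (by norm_num) (by norm_num) (by norm_num) (by norm_num) (by norm_num))
    h68 h89 (by rwa [dist_comm]) (by rwa [dist_comm])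
  have e12 := rh_sq _ _ h12
  have e23 := rh_sq _ _ h23
  have k0 : φ 1 0 - φ 2 0 = -2 * (φ 2 0 - φ 3 0) := by linarith [r1.1, r2.1, r3.1, r4.1]
  have k1 : φ 1 1 - φ 2 1 = -2 * (φ 2 1 - φ 3 1) := by linarith [r1.2, r2.2, r3.2, r4.2]
  rw [k0, k1] at e12
  linarith
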